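/- Let w_{ij} = w_{ji} (0 ≤ i, j ≤ N, i ≠ j) be arbitrary real weights, let L be the associated (N+1)×(N+1) weighted graph Laplacian, and let v_0, …, v_N ∈ ℝ^N be arbitrary points. Define n_i = ∑_{j≠i} w_{ij}(v_j − v_i) ∈ ℝ^N for each i. Then the determinant of the N×N matrix with columns n_1, …, n_N equals det(L̂_00) · det[v_1−v_0, …, v_N−v_0], where L̂_00 is L with row 0 and column 0 removed. -/

import Mathlib

open Finset

/-- The weighted graph Laplacian: `L i j = w i j` for `i ≠ j`,
and `L i i = −∑_{j ≠ i} w i j`. -/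
noncomputable def lap {N : ℕ} (w : Fin (N+1) → Fin (N+1) → ℝ) :
    Matrix (Fin (N+1)) (Fin (N+1)) ℝ :=
  Matrix.of fun i j => if i = j then -(∑ k ∈ Finset.univ.erase i, w i k) else w i j

/-- The weighted sum of the edge vectors at `i` is row `i` of the Laplacian applied to the
points translated by any base point. -/
theorem sum_smul_sub_eq_sum_lap_smul {N : ℕ} {E : Type*} [AddCommGroup E] [Module ℝ E]
    (w : Fin (N+1) → Fin (N+1) → ℝ) (v : Fin (N+1) → E) (x : E) (i : Fin (N+1)) :
    ∑ j ∈ Finset.univ.erase i, w i j • (v j - v i) = ∑ j, lap w i j • (v j - x) := by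
  have off_diag : ∑ j ∈ Finset.univ.erase i, lap w i j • (v j - x) =
      ∑ j ∈ Finset.univ.erase i, w i j • (v j - x) :=
    Finset.sum_congr rfl fun j hj => by
      simp [lap, (Finset.ne_of_mem_erase hj).symm]
  have diag : lap w i i = -∑ k ∈ Finset.univ.erase i, w i k := by simp [lap]
  rw [← Finset.add_sum_erase _ _ (Finset.mem_univ i), off_diag, diag, neg_smul,
    Finset.sum_smul, neg_add_eq_sub, ← Finset.sum_sub_distrib]
  refine Finset.sum_congr rfl fun j _ => ?_
  rw [← smul_sub, sub_sub_sub_cancel_right]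

/-- For arbitrary symmetric weights `w` with Laplacian `L` and arbitrary
points `v 0, …, v N ∈ ℝ^N`, setting `n i = ∑_{j≠i} w i j • (v j − v i)`, the determinant
of the `N×N` matrix with columns `n 1, …, n N` equals
`det(L̂₀₀) · det[v 1 − v 0, …, v N − v 0]`, where `L̂₀₀` is `L` with row 0 and
column 0 removed. -/
theorem det_normals_eq_det_laplacian_mul_det {N : ℕ}
    (w : Fin (N+1) → Fin (N+1) → ℝ) (hw : ∀ i j, w i j = w j i)
    (v : Fin (N+1) → EuclideanSpace ℝ (Fin N)) :
    Matrix.det (Matrix.of fun r c : Fin N =>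
        (∑ j ∈ Finset.univ.erase c.succ, w c.succ j • (v j - v c.succ)) r) =
      Matrix.det (Matrix.submatrix (lap w) Fin.succ Fin.succ) *
        Matrix.det (Matrix.of fun r c : Fin N => (v c.succ - v 0) r) := by
  rw [← Matrix.det_transpose (Matrix.submatrix (lap w) Fin.succ Fin.succ), mul_comm,
    ← Matrix.det_mul]
  congr 1
  ext r c
  rw [Matrix.of_apply, sum_smul_sub_eq_sum_lap_smul w v (v 0), Fin.sum_univ_succ]
  simp [Matrix.mul_apply, mul_comm]
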